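/- arXiv:2102.03938 — 3 statements merged into one kernel-verified Lean document; each statement's English description precedes it below -/
import Mathlib

section
/- Assume condition (C2): there exists L₁ > 0 such that ‖G(t,u,y) − G(t,ũ,y)‖ ≥ L₁‖u − ũ‖ for all t ∈ ℝ, u, ũ ∈ Λ, y ∈ ℝ^n. If x, x̄ ∈ 𝒜 and a differentiable function φ : ℝ → ℝ^n satisfies both φ'(t) = A φ(t) + G(t, x(t), φ(t−τ)) and φ'(t) = A φ(t) + G(t, x̄(t), φ(t−τ)) for all t ∈ ℝ, then x(t) = x̄(t) for all t ∈ ℝ. (In particular, the correspondence x ↦ φ_x between bounded solutions of the generator and bounded solutions of the replicator is one-to-one.) -/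
open MeasureTheory Matrix Set

noncomputable section

/-- Under (C2), if a differentiable function `φ` solves the replicator system driven both by
`x ∈ 𝒜` and by `x̄ ∈ 𝒜`, then `x = x̄`; i.e. the correspondence `x ↦ φ_x` is one-to-one. -/
theorem generator_determined_by_replicator
    (m n : ℕ) (hm : 0 < m) (hn : 0 < n)
    (T : ℝ) (hT : 0 < T)
    (F : ℝ → EuclideanSpace ℝ (Fin m) → EuclideanSpace ℝ (Fin m))
    (hFcont : Continuous fun p : ℝ × EuclideanSpace ℝ (Fin m) => F p.1 p.2)
    (hFper : ∀ (t : ℝ) (u : EuclideanSpace ℝ (Fin m)), F (t + T) u = F t u)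
    (Λ : Set (EuclideanSpace ℝ (Fin m))) (hΛ : IsCompact Λ)
    (𝒜 : Set (ℝ → EuclideanSpace ℝ (Fin m))) (h𝒜ne : 𝒜.Nonempty)
    (h𝒜 : ∀ x ∈ 𝒜, (∀ t : ℝ, HasDerivAt x (F t (x t)) t) ∧ ∀ t : ℝ, x t ∈ Λ)
    (A : Matrix (Fin n) (Fin n) ℝ)
    (τ : ℝ) (hτ : 0 < τ)
    (G : ℝ → EuclideanSpace ℝ (Fin m) → EuclideanSpace ℝ (Fin n) → EuclideanSpace ℝ (Fin n))
    (hGcont : Continuous fun p : ℝ × EuclideanSpace ℝ (Fin m) × EuclideanSpace ℝ (Fin n) =>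
      G p.1 p.2.1 p.2.2)
    (hGper : ∀ (t : ℝ) (u : EuclideanSpace ℝ (Fin m)) (y : EuclideanSpace ℝ (Fin n)),
      G (t + T) u y = G t u y)
    (L₁ : ℝ) (hL₁ : 0 < L₁)
    (hC2 : ∀ (t : ℝ), ∀ u ∈ Λ, ∀ v ∈ Λ, ∀ y : EuclideanSpace ℝ (Fin n),
      L₁ * ‖u - v‖ ≤ ‖G t u y - G t v y‖)
    (x x' : ℝ → EuclideanSpace ℝ (Fin m)) (hx : x ∈ 𝒜) (hx' : x' ∈ 𝒜)
    (φ : ℝ → EuclideanSpace ℝ (Fin n))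
    (hφdiff : ∀ t : ℝ, DifferentiableAt ℝ φ t)
    (hφx : ∀ t : ℝ,
      HasDerivAt φ ((toEuclideanCLM (𝕜 := ℝ) A) (φ t) + G t (x t) (φ (t - τ))) t)
    (hφx' : ∀ t : ℝ,
      HasDerivAt φ ((toEuclideanCLM (𝕜 := ℝ) A) (φ t) + G t (x' t) (φ (t - τ))) t) :
    ∀ t : ℝ, x t = x' t := by
  intro t
  have hG : G t (x t) (φ (t - τ)) = G t (x' t) (φ (t - τ)) :=
    add_left_cancel ((hφx t).unique (hφx' t))
  have h := hC2 t (x t) ((h𝒜 x hx).2 t) (x' t) ((h𝒜 x' hx').2 t) (φ (t - τ))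
  rw [hG, sub_self, norm_zero] at h
  exact sub_eq_zero.mp (norm_le_zero_iff.mp (nonpos_of_mul_nonpos_right h hL₁))
end
end

section
/- Let n be a positive integer, α ∈ ℝ, ξ > 0, c > 0, and let Δ : ℝ → ℝ^n be continuous. Suppose there exists η ∈ [α, α+ξ] with ‖Δ(η)‖ > c (Euclidean norm), and suppose each component satisfies |Δ_i(t₁) − Δ_i(t₂)| < c/(2√n) for all t₁, t₂ ∈ [α, α+ξ] and all i = 1, …, n. Then ‖∫_α^{α+ξ} Δ(s) ds‖ > ξ c/(2√n). -/
open MeasureTheory Set intervalIntegral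

noncomputable section

/-- Some coordinate of a vector whose norm exceeds `c` exceeds `c / √n` in absolute value. -/
theorem EuclideanSpace.exists_div_sqrt_lt_abs_apply {n : ℕ} {c : ℝ} (hc : 0 ≤ c)
    {v : EuclideanSpace ℝ (Fin n)} (hv : c < ‖v‖) : ∃ i, c / Real.sqrt n < |v i| := by
  by_contra! h
  refine hv.not_ge (pow_le_pow_iff_left₀ (norm_nonneg v) hc two_ne_zero |>.1 ?_)
  rw [EuclideanSpace.norm_sq_eq]
  calc ∑ i, ‖v i‖ ^ 2 ≤ ∑ _i : Fin n, (c / Real.sqrt n) ^ 2 := by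
        gcongr with i
        exact h i
    _ = n * (c ^ 2 / n) := by simp [div_pow]
    _ ≤ c ^ 2 := by
        rcases eq_or_ne (n : ℝ) 0 with hn | hn
        · simp [hn, sq_nonneg]
        · rw [mul_div_cancel₀ _ hn]

/-- If a continuous function `Δ : ℝ → ℝⁿ` satisfies `‖Δ(η)‖ > c` at some point `η` of
`[α, α+ξ]` and each of its components oscillates by less than `c/(2√n)` on `[α, α+ξ]`, then
`‖∫_α^{α+ξ} Δ(s) ds‖ > ξc/(2√n)`. -/
theorem integral_norm_lower_bound_of_small_oscillation
    (n : ℕ) (hn : 0 < n)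
    (α ξ c : ℝ) (hξ : 0 < ξ) (hc : 0 < c)
    (Δ : ℝ → EuclideanSpace ℝ (Fin n)) (hΔ : Continuous Δ)
    (hη : ∃ η ∈ Icc α (α + ξ), c < ‖Δ η‖)
    (hosc : ∀ i : Fin n, ∀ t₁ ∈ Icc α (α + ξ), ∀ t₂ ∈ Icc α (α + ξ),
      |Δ t₁ i - Δ t₂ i| < c / (2 * Real.sqrt n)) :
    ξ * c / (2 * Real.sqrt n) < ‖∫ s in α..(α + ξ), Δ s‖ := by
  obtain ⟨η, hηI, hcη⟩ := hη
  obtain ⟨j, hj⟩ := EuclideanSpace.exists_div_sqrt_lt_abs_apply hc.le hcη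
  have hcont : Continuous fun s => Δ s j := by fun_prop
  have hcoord : (∫ s in α..(α + ξ), Δ s) j = ∫ s in α..(α + ξ), Δ s j :=
    ((EuclideanSpace.proj (𝕜 := ℝ) j).intervalIntegral_comp_comm
      (hΔ.intervalIntegrable α (α + ξ))).symm
  have hdev : |(∫ s in α..(α + ξ), Δ s j) - ξ * Δ η j| ≤ c / (2 * Real.sqrt n) * ξ := by
    have hsub : ∫ s in α..(α + ξ), (Δ s j - Δ η j) =
        (∫ s in α..(α + ξ), Δ s j) - ξ * Δ η j := by
      rw [integral_sub (hcont.intervalIntegrable _ _) intervalIntegrable_const]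
      simp
    have hbound := norm_integral_le_of_norm_le_const (a := α) (b := α + ξ)
      (f := fun s => Δ s j - Δ η j) (C := c / (2 * Real.sqrt n)) fun s hs => by
        rw [uIoc_of_le (by linarith)] at hs
        exact (hosc j s (Ioc_subset_Icc_self hs) η hηI).le
    rwa [hsub, add_sub_cancel_left, abs_of_pos hξ] at hbound
  have htriangle : ξ * |Δ η j| ≤
      |∫ s in α..(α + ξ), Δ s j| + |(∫ s in α..(α + ξ), Δ s j) - ξ * Δ η j| := by
    rw [← abs_of_pos hξ, ← abs_mul, abs_of_pos hξ]
    linarith [abs_sub_abs_le_abs_sub (ξ * Δ η j) (∫ s in α..(α + ξ), Δ s j),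
      abs_sub_comm (ξ * Δ η j) (∫ s in α..(α + ξ), Δ s j)]
  have hhalf : ξ * (c / Real.sqrt n) =
      ξ * c / (2 * Real.sqrt n) + c / (2 * Real.sqrt n) * ξ := by
    have : Real.sqrt n ≠ 0 := by positivity
    field_simp
    ring
  calc ξ * c / (2 * Real.sqrt n) < |∫ s in α..(α + ξ), Δ s j| := by
        linarith [mul_lt_mul_of_pos_left hj hξ]
    _ ≤ ‖∫ s in α..(α + ξ), Δ s‖ := by
        rw [← hcoord]
        exact PiLp.norm_apply_le (∫ s in α..(α + ξ), Δ s) j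
end
end

section
/- Assume condition (C4): ‖G(t,u,y) − G(t,u,ỹ)‖ ≤ L₃‖y − ỹ‖ for all t ∈ ℝ, u ∈ Λ, y, ỹ ∈ ℝ^n. Let x, x̄ ∈ 𝒜 and let φ_x, φ_{x̄} : ℝ → ℝ^n be solutions of the replicator systems driven by x and x̄ respectively (φ'(t) = Aφ(t) + G(t, x(t), φ(t−τ)), and analogously for x̄). Let α ∈ ℝ, ξ > 0 and B > 0, and suppose ‖∫_α^{α+ξ} ( G(s, x(s), φ_x(s−τ)) − G(s, x̄(s), φ_x(s−τ)) ) ds‖ > B. Then max_{t ∈ [α−τ, α+ξ]} ‖φ_x(t) − φ_{x̄}(t)‖ > B/(2 + ξ‖A‖ + ξL₃), where ‖A‖ is the spectral norm of A. (With B = ξL₁ε₀/(2√n) this gives the estimate max_{t∈[α−τ,α+ξ]}‖φ_x(t) − φ_{x̄}(t)‖ > ξL₁ε₀/(2(2 + ξ‖A‖ + ξL₃)√n) used in the proof of Theorem 3.1.) -/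
open MeasureTheory Matrix Set intervalIntegral

noncomputable section

/-- If `d' = f + g` on `ℝ`, then the integral of `g` is controlled by the values of `d` at the
endpoints and a uniform bound on `f`. -/
theorem norm_integral_le_of_hasDerivAt_add {E : Type*} [NormedAddCommGroup E] [NormedSpace ℝ E]
    [CompleteSpace E] {d f g : ℝ → E} (hf : Continuous f) (hg : Continuous g)
    (hd : ∀ t, HasDerivAt d (f t + g t) t) {a b C : ℝ} (hab : a ≤ b)
    (hC : ∀ t ∈ Icc a b, ‖f t‖ ≤ C) :
    ‖∫ s in a..b, g s‖ ≤ ‖d b‖ + ‖d a‖ + C * (b - a) := by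
  have hftc : ∫ s in a..b, (f s + g s) = d b - d a :=
    integral_eq_sub_of_hasDerivAt (fun t _ => hd t) ((hf.add hg).intervalIntegrable a b)
  rw [integral_add (hf.intervalIntegrable a b) (hg.intervalIntegrable a b)] at hftc
  have hfint : ‖∫ s in a..b, f s‖ ≤ C * (b - a) := by
    have h := norm_integral_le_of_norm_le_const (a := a) (b := b) (f := f) (C := C)
      fun t ht => hC t (by rw [uIoc_of_le hab] at ht; exact Ioc_subset_Icc_self ht)
    rwa [abs_of_nonneg (sub_nonneg.2 hab)] at h
  rw [eq_sub_of_add_eq' hftc]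
  exact (norm_sub_le _ _).trans (add_le_add (norm_sub_le _ _) hfint)

/-- Under (C4), if the integral of the difference of the driving terms over `[α, α+ξ]` has norm
greater than `B`, then the bounded solutions `φ_x` and `φ_x̄` of the replicator systems driven
by `x` and `x̄` diverge: `max_{[α-τ, α+ξ]} ‖φ_x - φ_x̄‖ > B/(2 + ξ‖A‖ + ξL₃)`. -/
theorem divergence_of_replicator_solutions
    (m n : ℕ) (hm : 0 < m) (hn : 0 < n)
    (F : ℝ → EuclideanSpace ℝ (Fin m) → EuclideanSpace ℝ (Fin m))
    (hFcont : Continuous fun p : ℝ × EuclideanSpace ℝ (Fin m) => F p.1 p.2)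
    (Λ : Set (EuclideanSpace ℝ (Fin m))) (hΛ : IsCompact Λ)
    (𝒜 : Set (ℝ → EuclideanSpace ℝ (Fin m))) (h𝒜ne : 𝒜.Nonempty)
    (h𝒜 : ∀ x ∈ 𝒜, (∀ t : ℝ, HasDerivAt x (F t (x t)) t) ∧ ∀ t : ℝ, x t ∈ Λ)
    (A : Matrix (Fin n) (Fin n) ℝ)
    (τ : ℝ) (hτ : 0 < τ)
    (G : ℝ → EuclideanSpace ℝ (Fin m) → EuclideanSpace ℝ (Fin n) → EuclideanSpace ℝ (Fin n))
    (hGcont : Continuous fun p : ℝ × EuclideanSpace ℝ (Fin m) × EuclideanSpace ℝ (Fin n) =>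
      G p.1 p.2.1 p.2.2)
    (L₃ : ℝ) (hL₃ : 0 < L₃)
    -- (C4)
    (hC4 : ∀ (t : ℝ), ∀ u ∈ Λ, ∀ y y' : EuclideanSpace ℝ (Fin n),
      ‖G t u y - G t u y'‖ ≤ L₃ * ‖y - y'‖)
    (x x' : ℝ → EuclideanSpace ℝ (Fin m)) (hx : x ∈ 𝒜) (hx' : x' ∈ 𝒜)
    (φx φx' : ℝ → EuclideanSpace ℝ (Fin n))
    (hφxsol : ∀ t : ℝ,
      HasDerivAt φx ((toEuclideanCLM (𝕜 := ℝ) A) (φx t) + G t (x t) (φx (t - τ))) t)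
    (hφx'sol : ∀ t : ℝ,
      HasDerivAt φx' ((toEuclideanCLM (𝕜 := ℝ) A) (φx' t) + G t (x' t) (φx' (t - τ))) t)
    (α ξ B : ℝ) (hξ : 0 < ξ) (hB : 0 < B)
    (hint : B < ‖∫ s in α..(α + ξ),
      (G s (x s) (φx (s - τ)) - G s (x' s) (φx (s - τ)))‖) :
    ∃ t ∈ Icc (α - τ) (α + ξ),
      B / (2 + ξ * ‖toEuclideanCLM (𝕜 := ℝ) A‖ + ξ * L₃) < ‖φx t - φx' t‖ := by
  by_contra! hle
  have hcx : Continuous x := continuous_iff_continuousAt.2 fun t =>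
    ((h𝒜 x hx).1 t).continuousAt
  have hcx' : Continuous x' := continuous_iff_continuousAt.2 fun t =>
    ((h𝒜 x' hx').1 t).continuousAt
  have hcφ : Continuous φx := continuous_iff_continuousAt.2 fun t => (hφxsol t).continuousAt
  have hcφ' : Continuous φx' := continuous_iff_continuousAt.2 fun t => (hφx'sol t).continuousAt
  have hcG : ∀ u : ℝ → EuclideanSpace ℝ (Fin m), ∀ φ : ℝ → EuclideanSpace ℝ (Fin n),
      Continuous u → Continuous φ → Continuous fun s => G s (u s) (φ (s - τ)) :=
    fun u φ hu hφ => hGcont.comp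
      (continuous_id.prodMk (hu.prodMk (hφ.comp (continuous_id.sub continuous_const))))
  set T := toEuclideanCLM (𝕜 := ℝ) A
  set M := B / (2 + ξ * ‖T‖ + ξ * L₃)
  have hD : 0 < 2 + ξ * ‖T‖ + ξ * L₃ := by positivity
  have hMD : M * (2 + ξ * ‖T‖ + ξ * L₃) = B := div_mul_cancel₀ B hD.ne'
  have key := norm_integral_le_of_hasDerivAt_add
    (d := fun t => φx t - φx' t)
    (f := fun s => T (φx s - φx' s) + (G s (x' s) (φx (s - τ)) - G s (x' s) (φx' (s - τ))))
    (g := fun s => G s (x s) (φx (s - τ)) - G s (x' s) (φx (s - τ)))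
    (a := α) (b := α + ξ) (C := ‖T‖ * M + L₃ * M)
    ((T.continuous.comp (hcφ.sub hcφ')).add ((hcG x' φx hcx' hcφ).sub (hcG x' φx' hcx' hcφ')))
    ((hcG x φx hcx hcφ).sub (hcG x' φx hcx' hcφ))
    (fun t => by
      refine ((hφxsol t).sub (hφx'sol t)).congr_deriv ?_
      rw [map_sub]
      abel)
    (by linarith)
    (fun t ht => by
      refine (norm_add_le _ _).trans (add_le_add ?_ ?_)
      · exact (T.le_opNorm _).trans (mul_le_mul_of_nonneg_left
          (hle t ⟨by linarith [ht.1], ht.2⟩) (norm_nonneg _))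
      · exact (hC4 t _ ((h𝒜 x' hx').2 t) _ _).trans (mul_le_mul_of_nonneg_left
          (hle (t - τ) ⟨by linarith [ht.1], by linarith [ht.2]⟩) hL₃.le))
  have hend := hle (α + ξ) ⟨by linarith, le_rfl⟩
  have hstart := hle α ⟨by linarith, by linarith⟩
  linarith
end
end
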